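/- arXiv:1111.7301 — 3 statements merged into one kernel-verified Lean document; each statement's English description precedes it below -/
import Mathlib

section
/- Let Ω be a bounded open set in ℝⁿ and p ∈ [1,∞). For measurable v on Ω, the Dini semi-norm satisfies the identity |v|_{0,Dini(p),Ω}^p = n ∫₀^{+∞} ω̄(v,t)_p^p / t dt, where ω̄(v,t)_p^p = t^{−n} ∫_{|h| ≤ t} ∫_Ω |Δ_h v(x)|^p dx dh is the p-th power of the averaged modulus of smoothness, with Δ_h v(x) = v(x+h) − v(x) if both x and x+h lie in Ω, and Δ_h v(x) = 0 otherwise. -/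
open MeasureTheory Filter Topology Set Metric Bornology
open scoped ENNReal RealInnerProductSpace Real NNReal

noncomputable section

/-- Euclidean space `ℝⁿ`. -/
abbrev En (n : ℕ) : Type := EuclideanSpace ℝ (Fin n)

/-- The multi-index `α + eᵢ`. -/
def succIdx {n : ℕ} (α : Fin n → ℕ) (i : Fin n) : Fin n → ℕ :=
  Function.update α i (α i + 1)

/-- `D` is a coherent system of weak (distributional) partial derivatives on the open set
`Ω ⊆ ℝⁿ`: for every multi-index `α`, every direction `i` and every smooth test function `φ`
compactly supported in `Ω`, one has `∫_Ω (D α) ∂ᵢφ = - ∫_Ω (D (α+eᵢ)) φ`.  In particular each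
`D α` is the weak derivative `∂^α (D 0)`. -/
def IsWeakDerivSystemOn {n : ℕ} (Ω : Set (En n)) (D : (Fin n → ℕ) → En n → ℝ) : Prop :=
  ∀ (α : Fin n → ℕ) (i : Fin n) (φ : En n → ℝ),
    ContDiff ℝ (⊤ : ℕ∞) φ → HasCompactSupport φ → tsupport φ ⊆ Ω →
      ∫ x in Ω, D α x * fderiv ℝ φ x (EuclideanSpace.single i 1) =
        - ∫ x in Ω, D (succIdx α i) x * φ x

/-- `p`-th power of the integer-order Sobolev semi-norm
`|v|_{j,p,Ω}^p = ∑_{|α|=j} ∫_Ω |∂^α v|^p`. -/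
def sobSemiP {n : ℕ} (p : ℝ) (j : ℕ) (Ω : Set (En n))
    (D : (Fin n → ℕ) → En n → ℝ) : ℝ≥0∞ :=
  ∑' α : {α : Fin n → ℕ // ∑ i, α i = j}, ∫⁻ x in Ω, ENNReal.ofReal (|D α.1 x| ^ p)

/-- `p`-th power of the intrinsic (Gagliardo) semi-norm of order `l + σ`:
`|v|_{l+σ,p,Ω}^p = ∑_{|α|=l} ∬_{Ω×Ω} |∂^α v(x) - ∂^α v(y)|^p / |x-y|^{n+pσ}`.
(For `σ = 0` this is the Dini semi-norm `|v|_{l,Dini(p),Ω}^p`.) -/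
def gagSemiP {n : ℕ} (p : ℝ) (l : ℕ) (σ : ℝ) (Ω : Set (En n))
    (D : (Fin n → ℕ) → En n → ℝ) : ℝ≥0∞ :=
  ∑' α : {α : Fin n → ℕ // ∑ i, α i = l},
    ∫⁻ x in Ω, ∫⁻ y in Ω,
      ENNReal.ofReal (|D α.1 x - D α.1 y| ^ p / dist x y ^ ((n : ℝ) + p * σ))

/-- `p`-th power of the gradient semi-norm
`|∇v|_{l,p,Ω}^p = ∑_{|α|=l} ∫_Ω |∇(∂^α v)|^p`. -/
def gradSemiP {n : ℕ} (p : ℝ) (l : ℕ) (Ω : Set (En n))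
    (D : (Fin n → ℕ) → En n → ℝ) : ℝ≥0∞ :=
  ∑' α : {α : Fin n → ℕ // ∑ i, α i = l},
    ∫⁻ x in Ω, ENNReal.ofReal ((∑ i, (D (succIdx α.1 i) x) ^ 2) ^ (p / 2))

/-- `v = D 0` belongs to `W^{m,p}(Ω)` with weak derivatives `D α`, `|α| ≤ m`. -/
def MemWInt {n : ℕ} (p : ℝ) (m : ℕ) (Ω : Set (En n))
    (D : (Fin n → ℕ) → En n → ℝ) : Prop :=
  IsWeakDerivSystemOn Ω D ∧
    ∀ α : Fin n → ℕ, (∑ i, α i) ≤ m →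
      MemLp (D α) (ENNReal.ofReal p) (volume.restrict Ω)

/-- `Ω ⊆ ℝⁿ` has a Lipschitz-continuous boundary: near each boundary point, in suitable
orthonormal coordinates (a unit direction `ν` and its orthogonal hyperplane), `Ω` coincides
with the open epigraph of a Lipschitz function. -/
def HasLipschitzBoundary {n : ℕ} (Ω : Set (En n)) : Prop :=
  ∀ x ∈ frontier Ω,
    ∃ (ν : En n) (K : ℝ≥0) (ε : ℝ) (f : En n → ℝ), ‖ν‖ = 1 ∧ 0 < ε ∧
      LipschitzWith K f ∧
      ∀ y ∈ Metric.ball x ε, (y ∈ Ω ↔ f (y - ⟪y, ν⟫ • ν) < ⟪y, ν⟫)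

/-- The constant `K_{p,n} = ∫_{S^{n-1}} |ω·ν|^p dω`, the sphere carrying its surface
measure `volume.toSphere`. -/
def spherePow (n : ℕ) (p : ℝ) (ν : En n) : ℝ :=
  ∫ ω : Metric.sphere (0 : En n) 1, |⟪(ω : En n), ν⟫| ^ p ∂ (volume.toSphere)

def dF {n : ℕ} (Ω : Set (En n)) (p : ℝ) (v : En n → ℝ) (x h : En n) : ℝ≥0∞ :=
  ENNReal.ofReal (|(Ω ∩ {z : En n | z + h ∈ Ω}).indicator (fun z => v (z + h) - v z) x| ^ p)

lemma dF_meas {n : ℕ} (Ω : Set (En n)) (hΩ : IsOpen Ω) (p : ℝ) (v : En n → ℝ)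
    (hv : Measurable v) : Measurable (fun q : En n × En n => dF Ω p v q.1 q.2) := by
  have : Measurable (({q : En n × En n | q.1 ∈ Ω ∧ q.1 + q.2 ∈ Ω}).indicator
      (fun q => v (q.1 + q.2) - v q.1)) := by
    refine Measurable.indicator (by fun_prop) ?_
    exact (measurable_fst hΩ.measurableSet).inter
      ((measurable_fst.add measurable_snd) hΩ.measurableSet)
  have h2 := ENNReal.measurable_ofReal.comp ((continuous_abs.measurable.comp this).pow_const p)
  exact h2

lemma dF_meas' {n : ℕ} (Ω : Set (En n)) (hΩ : IsOpen Ω) (p : ℝ) (v : En n → ℝ)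
    (hv : Measurable v) (h : En n) : Measurable (fun x : En n => dF Ω p v x h) := by
  have h1 : Measurable (fun x : En n => (x, h)) := measurable_id.prodMk measurable_const
  have h2 := Measurable.comp (dF_meas Ω hΩ p v hv) h1
  simpa only [Function.comp_def] using h2

lemma dF_zero {n : ℕ} (Ω : Set (En n)) (p : ℝ) (hp : p ≠ 0) (v : En n → ℝ) (x : En n) :
    dF Ω p v x 0 = 0 := by
  simp [dF, Real.zero_rpow hp]

set_option maxHeartbeats 1000000 in
theorem statement6 {n : ℕ} (hn : 0 < n) (Ω : Set (En n)) (hΩopen : IsOpen Ω)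
    (hΩbdd : IsBounded Ω) (p : ℝ) (hp : 1 ≤ p) (v : En n → ℝ) (hv : Measurable v) :
    (∫⁻ x in Ω, ∫⁻ y in Ω, ENNReal.ofReal (|v x - v y| ^ p / dist x y ^ (n : ℝ))) =
      (n : ℝ≥0∞) *
        ∫⁻ t in Ioi (0 : ℝ),
          (ENNReal.ofReal (t ^ (-(n : ℝ))) *
              ∫⁻ h in Metric.closedBall (0 : En n) t, ∫⁻ x in Ω,
                ENNReal.ofReal
                  (|(Ω ∩ {z : En n | z + h ∈ Ω}).indicator
                      (fun z => v (z + h) - v z) x| ^ p)) /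
            ENNReal.ofReal t := by
  have hp0 : p ≠ 0 := by linarith
  have hF : Measurable (fun q : En n × En n => dF Ω p v q.1 q.2) := dF_meas Ω hΩopen p v hv
  have hG : Measurable (fun h => ∫⁻ x in Ω, dF Ω p v x h) :=
    hF.lintegral_prod_left'
  have key : ∀ t ∈ Ioi (0:ℝ),
      (ENNReal.ofReal (t ^ (-(n : ℝ))) *
              ∫⁻ h in Metric.closedBall (0 : En n) t, ∫⁻ x in Ω, dF Ω p v x h) /
            ENNReal.ofReal t
      = ∫⁻ h : En n, (Ici ‖h‖).indicator (fun s => ENNReal.ofReal (s ^ (-(n:ℝ) - 1))) t *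
          ∫⁻ x in Ω, dF Ω p v x h := by
    intro t ht
    have ht' : (0:ℝ) < t := ht
    rw [← lintegral_indicator Metric.isClosed_closedBall.measurableSet, ENNReal.div_eq_inv_mul,
      ← mul_assoc, ← ENNReal.ofReal_inv_of_pos ht', ← ENNReal.ofReal_mul (by positivity),
      ← lintegral_const_mul _ (hG.indicator Metric.isClosed_closedBall.measurableSet)]
    refine lintegral_congr fun h => ?_
    have e : t⁻¹ * t ^ (-(n:ℝ)) = t ^ (-(n:ℝ) - 1) := by
      rw [Real.rpow_sub ht', Real.rpow_one]; ring
    by_cases hh : ‖h‖ ≤ t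
    · rw [indicator_of_mem (by simpa using hh), indicator_of_mem (by simpa using hh), e]
    · rw [indicator_of_notMem (by simpa using hh), indicator_of_notMem (by simpa using hh)]
      simp
  change _ = (n : ℝ≥0∞) * ∫⁻ t in Ioi (0 : ℝ), (ENNReal.ofReal (t ^ (-(n : ℝ))) *
              ∫⁻ h in Metric.closedBall (0 : En n) t, ∫⁻ x in Ω, dF Ω p v x h) /
            ENNReal.ofReal t
  rw [setLIntegral_congr_fun measurableSet_Ioi key]
  symm
  rw [lintegral_lintegral_swap]
  swap
  · refine Measurable.aemeasurable ?_
    refine Measurable.mul ?_ (hG.comp measurable_snd)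
    have : Measurable (({q : ℝ × En n | ‖q.2‖ ≤ q.1}).indicator
        (fun q => ENNReal.ofReal (q.1 ^ (-(n:ℝ) - 1)))) := by
      refine Measurable.indicator (by fun_prop) ?_
      exact measurableSet_le (by fun_prop) (by fun_prop)
    exact this
  have hmt : ∀ h : En n, Measurable
      ((Ici ‖h‖).indicator (fun s : ℝ => ENNReal.ofReal (s ^ (-(n:ℝ) - 1)))) := fun h =>
    Measurable.indicator (by fun_prop) measurableSet_Ici
  have hn' : (0:ℝ) < n := by exact_mod_cast hn
  have step : ∀ h : En n, (n : ℝ≥0∞) * ∫⁻ t in Ioi (0:ℝ),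
      (Ici ‖h‖).indicator (fun s : ℝ => ENNReal.ofReal (s ^ (-(n:ℝ) - 1))) t *
          ∫⁻ x in Ω, dF Ω p v x h
      = ∫⁻ x in Ω, ENNReal.ofReal ((‖h‖ ^ (n:ℝ))⁻¹) * dF Ω p v x h := by
    intro h
    by_cases h0 : h = 0
    · subst h0
      simp [dF_zero Ω p hp0 v]
    · have hpos : 0 < ‖h‖ := norm_pos_iff.mpr h0
      rw [lintegral_mul_const _ (hmt h), setLIntegral_indicator measurableSet_Ici]
      have e1 : Ici ‖h‖ ∩ Ioi (0:ℝ) = Ici ‖h‖ :=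
        inter_eq_left.mpr fun s hs => lt_of_lt_of_le hpos hs
      rw [e1, setLIntegral_congr Ioi_ae_eq_Ici.symm,
        ← ofReal_integral_eq_lintegral_ofReal
          (integrableOn_Ioi_rpow_of_lt (by linarith) hpos)
          ((ae_restrict_mem measurableSet_Ioi).mono fun s hs =>
            Real.rpow_nonneg (hpos.le.trans (le_of_lt hs)) _),
        integral_Ioi_rpow_of_lt (by linarith) hpos, ← mul_assoc,
        lintegral_const_mul _ (dF_meas' Ω hΩopen p v hv h),
        ← ENNReal.ofReal_natCast, ← ENNReal.ofReal_mul (by positivity)]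
      congr 2
      rw [show -(n:ℝ) - 1 + 1 = -(n:ℝ) by ring, Real.rpow_neg hpos.le]
      field_simp
  rw [← lintegral_const_mul]
  swap
  · refine Measurable.lintegral_prod_right' (f := fun q : En n × ℝ =>
      (Ici ‖q.1‖).indicator (fun s : ℝ => ENNReal.ofReal (s ^ (-(n:ℝ) - 1))) q.2 *
          ∫⁻ x in Ω, dF Ω p v x q.1) ?_
    refine Measurable.mul ?_ (hG.comp measurable_fst)
    have : Measurable (({q : En n × ℝ | ‖q.1‖ ≤ q.2}).indicator
        (fun q => ENNReal.ofReal (q.2 ^ (-(n:ℝ) - 1)))) := by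
      refine Measurable.indicator (by fun_prop) ?_
      exact measurableSet_le (by fun_prop) (by fun_prop)
    exact this
  rw [lintegral_congr step, lintegral_lintegral_swap]
  swap
  · refine Measurable.aemeasurable ?_
    exact Measurable.mul (by fun_prop) (hF.comp measurable_swap)
  symm
  refine setLIntegral_congr_fun hΩopen.measurableSet fun x hx => ?_
  beta_reduce
  rw [← lintegral_indicator hΩopen.measurableSet, ← lintegral_add_left_eq_self _ x]
  refine lintegral_congr fun h => ?_
  unfold dF
  by_cases hh : x + h ∈ Ω
  · rw [indicator_of_mem hh, indicator_of_mem (show x ∈ Ω ∩ {z : En n | z + h ∈ Ω} from ⟨hx, hh⟩),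
      ← ENNReal.ofReal_mul (by positivity), abs_sub_comm, dist_self_add_right, div_eq_inv_mul]
  · rw [indicator_of_notMem hh,
      indicator_of_notMem (show x ∉ Ω ∩ {z : En n | z + h ∈ Ω} from fun q => hh q.2)]
    simp [Real.zero_rpow hp0]
end
end

section
/- For every integer n ≥ 1 and every σ ∈ (0,1), the constant G_{σ,n} defined by the identity ∫_{ℝⁿ} |e^{i ξ·y} − 1|² / |y|^{n+2σ} dy = G_{σ,n} |ξ|^{2σ} (for all ξ ∈ ℝⁿ) equals 2 π^{(n+1)/2} Γ(σ + 1/2) / (Γ(σ + n/2) Γ(1 + 2σ) sin(πσ)). -/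
open MeasureTheory Filter Topology Set Metric Bornology
open scoped ENNReal RealInnerProductSpace Real NNReal

noncomputable section

/-- `M_σ = ∫₀^∞ 2(1 - cos t)/t^{1+2σ} dt`. -/
def Msig (σ : ℝ) : ℝ := ∫ t in Ioi (0 : ℝ), 2 * (1 - Real.cos t) / t ^ (1 + 2 * σ)


lemma aux_L1 {r c : ℝ} (hr : 0 < r) (hc : 0 < c) :
    ∫⁻ t in Ioi (0:ℝ), ENNReal.ofReal (t ^ (r - 1) * Real.exp (-(c * t))) =
      ENNReal.ofReal ((1 / c) ^ r * Real.Gamma r) := by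
  rw [← Real.integral_rpow_mul_exp_neg_mul_Ioi hr hc, ofReal_integral_eq_lintegral_ofReal]
  · have := integrableOn_rpow_mul_exp_neg_mul_rpow (p := 1) (s := r - 1) (b := c) (by linarith)
      one_pos hc
    simpa [IntegrableOn] using this
  · filter_upwards [ae_restrict_mem measurableSet_Ioi] with t ht
    have : (0:ℝ) < t := ht
    simp only [Pi.zero_apply]
    positivity

lemma aux_L1' {r c : ℝ} (hr : 0 < r) (hc : 0 < c) :
    ∫⁻ t in Ioi (0:ℝ), ENNReal.ofReal (t ^ (-r - 1) * Real.exp (-(c / t))) =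
      ENNReal.ofReal ((1 / c) ^ r * Real.Gamma r) := by
  have key : ∀ t ∈ Ioi (0:ℝ), (|(-1:ℝ)| * t ^ ((-1:ℝ) - 1)) •
      (fun t : ℝ => t ^ (r - 1) * Real.exp (-(c * t))) (t ^ (-1:ℝ)) =
      t ^ (-r - 1) * Real.exp (-(c / t)) := by
    intro t ht
    have ht : (0:ℝ) < t := ht
    simp only [smul_eq_mul, abs_neg, abs_one, one_mul]
    rw [← Real.rpow_mul ht.le, ← mul_assoc, ← Real.rpow_add ht, Real.rpow_neg_one, div_eq_mul_inv]
    ring_nf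
  have hi : IntegrableOn (fun t : ℝ => t ^ (-r - 1) * Real.exp (-(c / t))) (Ioi 0) := by
    have h0 := integrableOn_rpow_mul_exp_neg_mul_rpow (p := 1) (s := r - 1) (b := c) (by linarith)
      one_pos hc
    have h1 : IntegrableOn (fun t : ℝ => t ^ (r - 1) * Real.exp (-(c * t))) (Ioi 0) := by
      simpa [IntegrableOn] using h0
    rw [← integrableOn_Ioi_comp_rpow_iff _ (p := -1) (by norm_num)] at h1
    exact h1.congr_fun key measurableSet_Ioi
  rw [← Real.integral_rpow_mul_exp_neg_mul_Ioi hr hc,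
    ← integral_comp_rpow_Ioi _ (p := -1) (by norm_num), setIntegral_congr_fun measurableSet_Ioi key,
    ofReal_integral_eq_lintegral_ofReal hi]
  filter_upwards [ae_restrict_mem measurableSet_Ioi] with t ht
  have : (0:ℝ) < t := ht
  simp only [Pi.zero_apply]
  positivity

lemma aux_gauss {n : ℕ} (ξ : En n) (hξ : ‖ξ‖ = 1) {t : ℝ} (ht : 0 < t) :
    ∫⁻ y : En n, ENNReal.ofReal (2 * (1 - Real.cos ⟪ξ, y⟫) * Real.exp (-(‖y‖ ^ 2 / t))) =
      ENNReal.ofReal (2 * (π * t) ^ ((n:ℝ) / 2) * (1 - Real.exp (-(t / 4)))) := by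
  have hb : 0 < (((1 / t : ℝ)) : ℂ).re := by
    rw [Complex.ofReal_re]; positivity
  have e0 : ∀ y : En n, (Complex.exp (-((1 / t : ℝ) : ℂ) * ‖y‖ ^ 2 + 0 * (⟪ξ, y⟫ : ℝ))).re =
      Real.exp (-(‖y‖ ^ 2 / t)) := by
    intro y
    rw [show (-((1 / t : ℝ) : ℂ) * ‖y‖ ^ 2 + 0 * (⟪ξ, y⟫ : ℝ)) =
      ((-(‖y‖ ^ 2 / t) : ℝ) : ℂ) by push_cast; ring]
    rw [Complex.exp_ofReal_re]
  have e1 : ∀ y : En n, (Complex.exp (-((1 / t : ℝ) : ℂ) * ‖y‖ ^ 2 +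
      Complex.I * (⟪ξ, y⟫ : ℝ))).re =
      Real.exp (-(‖y‖ ^ 2 / t)) * Real.cos ⟪ξ, y⟫ := by
    intro y
    rw [show (-((1 / t : ℝ) : ℂ) * ‖y‖ ^ 2 + Complex.I * (⟪ξ, y⟫ : ℝ)) =
      ((-(‖y‖ ^ 2 / t) : ℝ) : ℂ) + (⟪ξ, y⟫ : ℝ) * Complex.I by push_cast; ring]
    rw [Complex.exp_add, ← Complex.ofReal_exp, Complex.re_ofReal_mul, Complex.exp_ofReal_mul_I_re]
  have i0 := GaussianFourier.integrable_cexp_neg_mul_sq_norm_add hb 0 ξ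
  have i1 := GaussianFourier.integrable_cexp_neg_mul_sq_norm_add hb Complex.I ξ
  have v0 := GaussianFourier.integral_cexp_neg_mul_sq_norm_add hb 0 ξ
  have v1 := GaussianFourier.integral_cexp_neg_mul_sq_norm_add hb Complex.I ξ
  have r0 := i0.re
  have r1 := i1.re
  have w0 := integral_re i0
  have w1 := integral_re i1
  rw [v0] at w0
  rw [v1] at w1
  simp only [RCLike.re_to_complex, e0, e1] at r0 r1 w0 w1
  have c : ((π:ℂ) / ((1 / t : ℝ) : ℂ)) ^ ((Module.finrank ℝ (En n) : ℂ) / 2) =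
      (((π * t) ^ ((n:ℝ) / 2) : ℝ) : ℂ) := by
    rw [Complex.ofReal_cpow (by positivity)]
    simp
  rw [c, hξ] at w0 w1
  rw [show (0:ℂ) ^ 2 * ((1:ℝ):ℂ) ^ 2 / (4 * ((1 / t : ℝ) : ℂ)) = ((0:ℝ):ℂ) by simp,
    ← Complex.ofReal_exp, ← Complex.ofReal_mul, Complex.ofReal_re] at w0
  rw [show Complex.I ^ 2 * ((1:ℝ):ℂ) ^ 2 / (4 * ((1 / t : ℝ) : ℂ)) = ((-(t / 4):ℝ):ℂ) by
      rw [Complex.I_sq]; push_cast; rw [one_div, ← div_div, div_inv_eq_mul]; ring,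
    ← Complex.ofReal_exp, ← Complex.ofReal_mul, Complex.ofReal_re] at w1
  have hfun : (fun y : En n => 2 * (1 - Real.cos ⟪ξ, y⟫) * Real.exp (-(‖y‖ ^ 2 / t))) =
      fun y => 2 * (Real.exp (-(‖y‖ ^ 2 / t)) - Real.exp (-(‖y‖ ^ 2 / t)) * Real.cos ⟪ξ, y⟫) := by
    funext y; ring
  rw [← ofReal_integral_eq_lintegral_ofReal]
  · rw [hfun, integral_const_mul, integral_sub r0 r1, w0, w1, Real.exp_zero]
    ring_nf
  · rw [hfun]
    exact (r0.sub r1).const_mul 2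
  · refine Eventually.of_forall fun y => ?_
    have := Real.cos_le_one ⟪ξ, y⟫
    have h2 : 0 ≤ 1 - Real.cos ⟪ξ, y⟫ := by linarith
    simp only [Pi.zero_apply]
    positivity

lemma aux_inner {σ t : ℝ} (ht : 0 < t) :
    ∫⁻ a in Ioc (0:ℝ) (1/4), ENNReal.ofReal (t ^ (-σ) * Real.exp (-(a * t))) =
      ENNReal.ofReal (t ^ (-σ - 1) * (1 - Real.exp (-(t / 4)))) := by
  have hcont : Continuous fun a : ℝ => t ^ (-σ) * Real.exp (-(a * t)) := by fun_prop
  rw [← ofReal_integral_eq_lintegral_ofReal]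
  · congr 1
    rw [← intervalIntegral.integral_of_le (by norm_num)]
    have hd : ∀ a ∈ uIcc (0:ℝ) (1/4), HasDerivAt
        (fun a : ℝ => -(t ^ (-σ - 1) * Real.exp (-(a * t))))
        (t ^ (-σ) * Real.exp (-(a * t))) a := by
      intro a _
      have h := ((((hasDerivAt_id a).mul_const t).neg).exp.const_mul (t ^ (-σ - 1))).neg
      convert! h using 1
      rw [Real.rpow_sub_one ht.ne']
      simp
      field_simp
    rw [intervalIntegral.integral_eq_sub_of_hasDerivAt hd (hcont.intervalIntegrable _ _)]
    simp only [zero_mul, neg_zero, Real.exp_zero]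
    ring_nf
  · exact (hcont.integrableOn_Icc).mono_set Ioc_subset_Icc_self
  · refine Eventually.of_forall fun a => ?_
    simp only [Pi.zero_apply]
    positivity

lemma aux_outer {σ : ℝ} (h0 : 0 < σ) (h1 : σ < 1) :
    ∫⁻ t in Ioi (0:ℝ), ENNReal.ofReal (t ^ (-σ - 1) * (1 - Real.exp (-(t / 4)))) =
      ENNReal.ofReal (Real.Gamma (1 - σ) * ((1/4) ^ σ / σ)) := by
  have s1 : ∫⁻ t in Ioi (0:ℝ), ENNReal.ofReal (t ^ (-σ - 1) * (1 - Real.exp (-(t / 4)))) =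
      ∫⁻ t in Ioi (0:ℝ), ∫⁻ a in Ioc (0:ℝ) (1/4),
        ENNReal.ofReal (t ^ (-σ) * Real.exp (-(a * t))) :=
    setLIntegral_congr_fun measurableSet_Ioi fun t ht => (aux_inner ht).symm
  rw [s1, lintegral_lintegral_swap (Measurable.aemeasurable (by fun_prop))]
  have s2 : ∫⁻ a in Ioc (0:ℝ) (1/4), ∫⁻ t in Ioi (0:ℝ),
        ENNReal.ofReal (t ^ (-σ) * Real.exp (-(a * t))) =
      ∫⁻ a in Ioc (0:ℝ) (1/4), ENNReal.ofReal (Real.Gamma (1 - σ) * a ^ (σ - 1)) := by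
    refine setLIntegral_congr_fun measurableSet_Ioc fun a ha => ?_
    have ha : 0 < a := ha.1
    have := aux_L1 (r := 1 - σ) (by linarith) ha
    rw [show 1 - σ - 1 = -σ by ring] at this
    rw [this, one_div, Real.inv_rpow ha.le, ← Real.rpow_neg ha.le, mul_comm]
    ring_nf
  have hg : 0 < Real.Gamma (1 - σ) := Real.Gamma_pos_of_pos (by linarith)
  rw [s2, ← ofReal_integral_eq_lintegral_ofReal]
  · rw [integral_const_mul, ← intervalIntegral.integral_of_le (by norm_num),
      integral_rpow (Or.inl (by linarith))]
    rw [show σ - 1 + 1 = σ by ring, Real.zero_rpow h0.ne', sub_zero]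
  · have := (intervalIntegral.intervalIntegrable_rpow' (a := 0) (b := 1/4)
      (show -1 < σ - 1 by linarith)).1
    exact this.const_mul _
  · filter_upwards [ae_restrict_mem measurableSet_Ioc] with a ha
    have : 0 < a := ha.1
    simp only [Pi.zero_apply]
    positivity

lemma aux_main {n : ℕ} (hn : 0 < n) {σ : ℝ} (h0 : 0 < σ) (h1 : σ < 1) (ξ : En n) (hξ : ‖ξ‖ = 1) :
    ENNReal.ofReal (Real.Gamma ((n:ℝ) / 2 + σ)) *
    ∫⁻ y : En n, ENNReal.ofReal (2 * (1 - Real.cos ⟪ξ, y⟫) / ‖y‖ ^ ((n : ℝ) + 2 * σ)) =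
      ENNReal.ofReal (2 * π ^ ((n:ℝ) / 2) * (Real.Gamma (1 - σ) * ((1/4) ^ σ / σ))) := by
  have hr : 0 < (n:ℝ) / 2 + σ := by positivity
  rw [← lintegral_const_mul' _ _ ENNReal.ofReal_ne_top]
  have s1 : ∀ y : En n, ENNReal.ofReal (Real.Gamma ((n:ℝ) / 2 + σ)) *
      ENNReal.ofReal (2 * (1 - Real.cos ⟪ξ, y⟫) / ‖y‖ ^ ((n : ℝ) + 2 * σ)) =
      ∫⁻ t in Ioi (0:ℝ), ENNReal.ofReal (2 * (1 - Real.cos ⟪ξ, y⟫) *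
        (t ^ (-((n:ℝ) / 2 + σ) - 1) * Real.exp (-(‖y‖ ^ 2 / t)))) := by
    intro y
    rcases eq_or_ne y 0 with rfl | hy
    · simp
    have hy' : 0 < ‖y‖ := norm_pos_iff.2 hy
    have := Real.cos_le_one ⟪ξ, y⟫
    have h2 : 0 ≤ 2 * (1 - Real.cos ⟪ξ, y⟫) := by linarith
    simp_rw [ENNReal.ofReal_mul h2]
    rw [lintegral_const_mul' _ _ ENNReal.ofReal_ne_top, aux_L1' hr (by positivity : 0 < ‖y‖ ^ 2),
      ← ENNReal.ofReal_mul h2, ← ENNReal.ofReal_mul (Real.Gamma_pos_of_pos hr).le]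
    congr 1
    rw [one_div, Real.inv_rpow (by positivity), ← Real.rpow_natCast, ← Real.rpow_mul hy'.le]
    push_cast
    rw [show 2 * ((n:ℝ) / 2 + σ) = n + 2 * σ by ring]
    ring
  simp_rw [s1]
  rw [lintegral_lintegral_swap (Measurable.aemeasurable (by fun_prop))]
  have s2 : ∫⁻ t in Ioi (0:ℝ), ∫⁻ y : En n, ENNReal.ofReal (2 * (1 - Real.cos ⟪ξ, y⟫) *
        (t ^ (-((n:ℝ) / 2 + σ) - 1) * Real.exp (-(‖y‖ ^ 2 / t)))) =
      ∫⁻ t in Ioi (0:ℝ), ENNReal.ofReal (2 * π ^ ((n:ℝ) / 2)) *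
        ENNReal.ofReal (t ^ (-σ - 1) * (1 - Real.exp (-(t / 4)))) := by
    refine setLIntegral_congr_fun measurableSet_Ioi fun t ht => ?_
    have ht : 0 < t := ht
    have hp : 0 ≤ t ^ (-((n:ℝ) / 2 + σ) - 1) := by positivity
    simp_rw [mul_left_comm _ (t ^ (-((n:ℝ) / 2 + σ) - 1)) _, ENNReal.ofReal_mul hp]
    rw [lintegral_const_mul' _ _ ENNReal.ofReal_ne_top, aux_gauss ξ hξ ht,
      ← ENNReal.ofReal_mul hp, ← ENNReal.ofReal_mul (by positivity)]
    congr 1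
    rw [Real.mul_rpow Real.pi_pos.le ht.le, show -σ - 1 = (-((n:ℝ) / 2 + σ) - 1) + (n:ℝ)/2 by ring,
      Real.rpow_add ht]
    ring
  rw [s2, lintegral_const_mul' _ _ ENNReal.ofReal_ne_top, aux_outer h0 h1,
    ← ENNReal.ofReal_mul (by positivity)]

theorem statement9 {n : ℕ} (hn : 0 < n) (σ : ℝ) (hσ : σ ∈ Ioo (0 : ℝ) 1) (G : ℝ)
    (hG : ∀ ξ : En n,
      (∫ y : En n,
          ‖Complex.exp (Complex.I * (⟪ξ, y⟫ : ℝ)) - 1‖ ^ 2 / ‖y‖ ^ ((n : ℝ) + 2 * σ)) =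
        G * ‖ξ‖ ^ (2 * σ)) :
    G = 2 * π ^ (((n : ℝ) + 1) / 2) * Real.Gamma (σ + 1 / 2) /
        (Real.Gamma (σ + (n : ℝ) / 2) * Real.Gamma (1 + 2 * σ) * Real.sin (π * σ)) := by
  obtain ⟨h0, h1⟩ := hσ
  have hn0 : (⟨0, hn⟩ : Fin n) = ⟨0, hn⟩ := rfl
  set ξ : En n := EuclideanSpace.single ⟨0, hn⟩ (1:ℝ) with hξd
  have hξ : ‖ξ‖ = 1 := by simp [hξd]
  have hnorm : ∀ y : En n, ‖Complex.exp (Complex.I * (⟪ξ, y⟫ : ℝ)) - 1‖ ^ 2 =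
      2 * (1 - Real.cos ⟪ξ, y⟫) := by
    intro y
    rw [mul_comm, ← Complex.normSq_eq_norm_sq, Complex.normSq_apply]
    simp only [Complex.sub_re, Complex.sub_im, Complex.exp_ofReal_mul_I_re,
      Complex.exp_ofReal_mul_I_im, Complex.one_re, Complex.one_im]
    nlinarith [Real.sin_sq_add_cos_sq ⟪ξ, y⟫]
  have h := hG ξ
  simp_rw [hnorm] at h
  rw [hξ, Real.one_rpow, mul_one, integral_eq_lintegral_of_nonneg_ae] at h
  rotate_left
  · refine Eventually.of_forall fun y => ?_
    have := Real.cos_le_one ⟪ξ, y⟫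
    have h2 : 0 ≤ 1 - Real.cos ⟪ξ, y⟫ := by linarith
    simp only [Pi.zero_apply]
    positivity
  · exact Measurable.aestronglyMeasurable (by fun_prop)
  have m := congrArg ENNReal.toReal (aux_main hn h0 h1 ξ hξ)
  have hr : 0 < (n:ℝ) / 2 + σ := by positivity
  have g1 := Real.Gamma_pos_of_pos hr
  have g2 : 0 < Real.Gamma (1 - σ) := Real.Gamma_pos_of_pos (by linarith)
  have g3 : 0 < Real.Gamma (1 + 2 * σ) := Real.Gamma_pos_of_pos (by linarith)
  have g4 : 0 < Real.Gamma σ := Real.Gamma_pos_of_pos h0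
  have g5 : 0 < Real.Gamma (σ + 1/2) := Real.Gamma_pos_of_pos (by linarith)
  have hs : 0 < Real.sin (π * σ) := Real.sin_pos_of_pos_of_lt_pi (by positivity)
    (by nlinarith [Real.pi_pos])
  rw [ENNReal.toReal_mul, ENNReal.toReal_ofReal g1.le, h, ENNReal.toReal_ofReal (by positivity)] at m
  have dup := Real.Gamma_mul_Gamma_add_half σ
  have refl' := Real.Gamma_mul_Gamma_one_sub σ
  have add1 : Real.Gamma (1 + 2 * σ) = 2 * σ * Real.Gamma (2 * σ) := by
    rw [add_comm, Real.Gamma_add_one (by positivity)]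
  have p4 : (2:ℝ) ^ (1 - 2 * σ) = 2 * (1/4) ^ σ := by
    rw [Real.rpow_sub two_pos, Real.rpow_one, Real.rpow_mul two_pos.le, one_div,
      Real.inv_rpow (by norm_num)]
    norm_num [div_eq_mul_inv]
  have ppi : π ^ (((n:ℝ) + 1) / 2) = π ^ ((n:ℝ) / 2) * √π := by
    rw [Real.sqrt_eq_rpow, ← Real.rpow_add Real.pi_pos]; ring_nf
  rw [p4] at dup
  rw [add_comm σ ((n:ℝ)/2), ppi, eq_div_iff (by positivity)]
  have hsq : √π * √π = π := Real.mul_self_sqrt Real.pi_pos.le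
  rw [eq_div_iff hs.ne'] at refl'
  have hsp : 0 < √π := Real.sqrt_pos.2 Real.pi_pos
  have m2 : G * Real.Gamma ((n:ℝ)/2 + σ) * σ =
      2 * π ^ ((n:ℝ) / 2) * Real.Gamma (1 - σ) * (1/4) ^ σ := by
    rw [mul_comm G, m]; field_simp
  rw [add1]
  have hne : Real.Gamma σ * √π ≠ 0 := by positivity
  apply mul_right_cancel₀ hne
  generalize π ^ ((n:ℝ) / 2) = P at *
  generalize ((1/4:ℝ)) ^ σ = Q at *
  generalize √π = R at *
  calc _ = (G * Real.Gamma ((n:ℝ)/2 + σ) * σ) * (2 * Real.Gamma (2*σ) * Real.sin (π * σ) * Real.Gamma σ * R) := by ring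
    _ = 2 * P * (Real.Gamma σ * Real.Gamma (1 - σ) * Real.sin (π * σ)) * (Real.Gamma (2*σ) * (2 * Q) * R) := by rw [m2]; ring
    _ = 2 * P * (R * R) * (Real.Gamma σ * Real.Gamma (σ + 1/2)) := by rw [refl', ← dup, hsq]
    _ = _ := by ring
end
end

section
/- Let σ ∈ (0,1) and let v ∈ L²(ℝⁿ) with Fourier transform v̂. Then |v|_{σ,2,ℝⁿ}² = (2π)^{−n} G_{σ,n} ∫_{ℝⁿ} |ξ|^{2σ} |v̂(ξ)|² dξ (an equality in [0,∞]), where G_{σ,n} = 2 π^{(n+1)/2} Γ(σ+1/2) / (Γ(σ+n/2) Γ(1+2σ) sin(πσ)). In particular, v ∈ W^{σ,2}(ℝⁿ) if and only if ∫_{ℝⁿ} |ξ|^{2σ} |v̂(ξ)|² dξ < ∞. -/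
open MeasureTheory Filter Topology Set Metric Bornology
open scoped ENNReal RealInnerProductSpace Real NNReal

noncomputable section

/-- The Fourier integral `f̂(ξ) = ∫ f(x) e^{-i x·ξ} dx` (defined pointwise when `f ∈ L¹`). -/
def ftIntegral {n : ℕ} (f : En n → ℂ) (ξ : En n) : ℂ :=
  ∫ x : En n, f x * Complex.exp (-(Complex.I * (⟪x, ξ⟫ : ℝ)))

/-- `w` is the Fourier transform (convention `v̂(ξ) = ∫ v(x) e^{-ix·ξ} dx`, extended from
`L¹ ∩ L²` to `L²`) of the square-integrable function `v`, characterized by the multiplication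
formula `∫ w φ = ∫ v φ̂` against Schwartz functions. -/
def IsL2FourierTransform {n : ℕ} (v w : En n → ℂ) : Prop :=
  MemLp w 2 volume ∧
    ∀ φ : SchwartzMap (En n) ℂ,
      ∫ ξ, w ξ * φ ξ = ∫ x, v x * ftIntegral (fun y => φ y) x

/-- The constant `G_{σ,n}`. -/
def Gconst (n : ℕ) (σ : ℝ) : ℝ :=
  2 * π ^ (((n : ℝ) + 1) / 2) * Real.Gamma (σ + 1 / 2) /
    (Real.Gamma (σ + (n : ℝ) / 2) * Real.Gamma (1 + 2 * σ) * Real.sin (π * σ))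

/-- Square of the Gagliardo semi-norm of order `l + σ` (with `p = 2`) of a complex-valued
function, given through a system `D` of weak derivatives. -/
def gagSemi2C {n : ℕ} (l : ℕ) (σ : ℝ) (D : (Fin n → ℕ) → En n → ℂ) : ℝ≥0∞ :=
  ∑' α : {α : Fin n → ℕ // ∑ i, α i = l},
    ∫⁻ x : En n, ∫⁻ y : En n,
      ENNReal.ofReal (‖D α.1 x - D α.1 y‖ ^ 2 / dist x y ^ ((n : ℝ) + 2 * σ))

/-- Complex-valued analogue of `IsWeakDerivSystemOn` on all of `ℝⁿ`. -/
def IsWeakDerivSystemC {n : ℕ} (D : (Fin n → ℕ) → En n → ℂ) : Prop :=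
  ∀ (α : Fin n → ℕ) (i : Fin n) (φ : En n → ℂ),
    ContDiff ℝ (⊤ : ℕ∞) φ → HasCompactSupport φ →
      ∫ x, D α x * fderiv ℝ φ x (EuclideanSpace.single i 1) =
        - ∫ x, D (succIdx α i) x * φ x

/-- `v ∈ W^{r,2}(ℝⁿ)` for real `r ≥ 0`: writing `r = l + σ` with `l = ⌊r⌋` and `σ ∈ [0,1)`,
there is a system of weak derivatives of `v` of order `≤ l` lying in `L²`, and if `σ > 0`
the Gagliardo semi-norm of order `r` is finite. -/
def MemW2 {n : ℕ} (r : ℝ) (v : En n → ℂ) : Prop :=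
  ∃ D : (Fin n → ℕ) → En n → ℂ, D 0 = v ∧ IsWeakDerivSystemC D ∧
    (∀ α : Fin n → ℕ, (∑ i, α i) ≤ ⌊r⌋₊ → MemLp (D α) 2 volume) ∧
    ((⌊r⌋₊ : ℝ) < r → gagSemi2C ⌊r⌋₊ (r - ⌊r⌋₊) D < ∞)

lemma gammaLint {a r : ℝ} (ha : 0 < a) (hr : 0 < r) :
    ∫⁻ t in Ioi (0:ℝ), ENNReal.ofReal (t ^ (a - 1) * Real.exp (-(r * t))) =
      ENNReal.ofReal ((1 / r) ^ a * Real.Gamma a) := by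
  rw [← Real.integral_rpow_mul_exp_neg_mul_Ioi ha hr, ofReal_integral_eq_lintegral_ofReal]
  · by_contra h
    have h0 := Real.integral_rpow_mul_exp_neg_mul_Ioi ha hr
    rw [integral_undef h] at h0
    have : 0 < (1 / r) ^ a * Real.Gamma a :=
      mul_pos (Real.rpow_pos_of_pos (by positivity) _) (Real.Gamma_pos_of_pos ha)
    linarith
  · filter_upwards [ae_restrict_mem measurableSet_Ioi] with t ht
    have : (0:ℝ) < t := ht
    positivity

lemma expLint {a : ℝ} (ha : 0 < a) {s : ℝ} (hs : 0 ≤ s) :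
    ∫⁻ u in Ioc 0 s, ENNReal.ofReal (a * Real.exp (-(a * u))) =
      ENNReal.ofReal (1 - Real.exp (-(a * s))) := by
  rw [← ofReal_integral_eq_lintegral_ofReal]
  · rw [← intervalIntegral.integral_of_le hs]
    congr 1
    have : ∀ x ∈ uIcc 0 s, HasDerivAt (fun u => - Real.exp (-(a * u))) (a * Real.exp (-(a * x))) x := by
      intro x _
      have h1 : HasDerivAt (fun u => -(a * u)) (-(a * 1)) x := ((hasDerivAt_id x).const_mul a).neg
      exact h1.exp.neg.congr_deriv (by ring)
    rw [intervalIntegral.integral_eq_sub_of_hasDerivAt this]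
    · simp only [mul_zero, neg_zero, Real.exp_zero]; ring
    · exact Continuous.intervalIntegrable (by fun_prop) _ _
  · exact (Continuous.integrableOn_Ioc (by fun_prop))
  · exact Eventually.of_forall fun u => by positivity

lemma rpowLint {σ : ℝ} (hσ : 0 < σ) {s : ℝ} (hs : 0 ≤ s) :
    ∫⁻ u in Ioc 0 s, ENNReal.ofReal (u ^ (σ - 1)) = ENNReal.ofReal (s ^ σ / σ) := by
  rw [← ofReal_integral_eq_lintegral_ofReal]
  · rw [← intervalIntegral.integral_of_le hs, integral_rpow (by left; linarith)]
    simp [Real.zero_rpow hσ.ne']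
  · rw [← IntegrableOn, ← intervalIntegrable_iff_integrableOn_Ioc_of_le hs]
    exact intervalIntegral.intervalIntegrable_rpow' (by linarith)
  · filter_upwards [ae_restrict_mem measurableSet_Ioc] with t ht
    have : (0:ℝ) < t := ht.1
    positivity

lemma kerC {σ : ℝ} (hσ : σ ∈ Ioo (0 : ℝ) 1) {a : ℝ} (ha : 0 < a) :
    ∫⁻ t in Ioi (0:ℝ), ENNReal.ofReal (t ^ (σ - 1) * (1 - Real.exp (-(a * t⁻¹)))) =
      ENNReal.ofReal (a ^ σ * Real.Gamma (1 - σ) / σ) := by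
  obtain ⟨h0, h1⟩ := hσ
  let F : ℝ → ℝ → ℝ≥0∞ := fun t u =>
    ({p : ℝ × ℝ | p.1 * p.2 ≤ 1}.indicator
      (fun p => ENNReal.ofReal (p.1 ^ (σ - 1)) * ENNReal.ofReal (a * Real.exp (-(a * p.2))))) (t, u)
  have hFm : Measurable (Function.uncurry F) := by
    have : Measurable (fun p : ℝ × ℝ => ENNReal.ofReal (p.1 ^ (σ - 1)) * ENNReal.ofReal (a * Real.exp (-(a * p.2)))) := by
      fun_prop
    exact this.indicator (measurableSet_le (by fun_prop) (by fun_prop))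
  have e1 : ∀ t ∈ Ioi (0:ℝ), ENNReal.ofReal (t ^ (σ - 1) * (1 - Real.exp (-(a * t⁻¹)))) =
      ∫⁻ u in Ioi (0:ℝ), F t u := by
    intro t ht
    have ht' : (0:ℝ) < t := ht
    rw [ENNReal.ofReal_mul (by positivity), ← expLint ha (by positivity),
      ← lintegral_const_mul _ (by fun_prop), ← lintegral_indicator measurableSet_Ioi,
      ← lintegral_indicator measurableSet_Ioc]
    congr 1; ext u
    simp only [indicator, F, mem_Ioc, mem_Ioi, Set.mem_ofPred_eq]
    by_cases hu : 0 < u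
    · have : u ≤ t⁻¹ ↔ t * u ≤ 1 := by rw [le_inv_comm₀ hu ht', ← one_div, le_div_iff₀ hu]
      simp [hu, this]
    · simp [hu]
  have e2 : ∀ u ∈ Ioi (0:ℝ), ∫⁻ t in Ioi (0:ℝ), F t u =
      ENNReal.ofReal (a / σ) * ENNReal.ofReal (u ^ ((1 - σ) - 1) * Real.exp (-(a * u))) := by
    intro u hu
    have hu' : (0:ℝ) < u := hu
    trans ENNReal.ofReal ((u⁻¹) ^ σ / σ) * ENNReal.ofReal (a * Real.exp (-(a * u)))
    · rw [← rpowLint h0 (by positivity),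
        ← lintegral_mul_const _ (by fun_prop), ← lintegral_indicator measurableSet_Ioi,
        ← lintegral_indicator measurableSet_Ioc]
      congr 1; ext t
      simp only [indicator, F, mem_Ioc, mem_Ioi, Set.mem_ofPred_eq]
      by_cases ht : 0 < t
      · have : t ≤ u⁻¹ ↔ t * u ≤ 1 := by rw [← one_div, le_div_iff₀ hu']
        simp [ht, this]
      · simp [ht]
    · rw [← ENNReal.ofReal_mul (by positivity), ← ENNReal.ofReal_mul (by positivity)]
      congr 1
      rw [Real.inv_rpow hu'.le, ← Real.rpow_neg hu'.le]
      rw [show 1 - σ - 1 = -σ by ring]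
      ring
  rw [setLIntegral_congr_fun measurableSet_Ioi e1, lintegral_lintegral_swap hFm.aemeasurable,
    setLIntegral_congr_fun measurableSet_Ioi e2, lintegral_const_mul _ (by fun_prop),
    gammaLint (by linarith) ha, ← ENNReal.ofReal_mul (by positivity)]
  congr 1
  rw [one_div, Real.inv_rpow ha.le, ← Real.rpow_neg ha.le]
  have : a ^ σ = a * a ^ (-(1 - σ)) := by
    nth_rewrite 2 [← Real.rpow_one a]
    rw [← Real.rpow_add ha]; congr 1; ring
  rw [this]; ring

lemma kerB {n : ℕ} (ξ : En n) {t : ℝ} (ht : 0 < t) :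
    ∫⁻ h : En n, ENNReal.ofReal (2 * (1 - Real.cos ⟪ξ, h⟫) * Real.exp (-t * ‖h‖ ^ 2)) =
      ENNReal.ofReal (2 * (π / t) ^ ((n : ℝ) / 2) * (1 - Real.exp (-(‖ξ‖ ^ 2 / 4 * t⁻¹)))) := by
  have htc : 0 < (t : ℂ).re := by simpa using ht
  have i0 := GaussianFourier.integrable_cexp_neg_mul_sq_norm_add (V := En n) htc 0 ξ
  have i1 := GaussianFourier.integrable_cexp_neg_mul_sq_norm_add (V := En n) htc Complex.I ξ
  have v0 := GaussianFourier.integral_cexp_neg_mul_sq_norm_add (V := En n) htc 0 ξ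
  have v1 := GaussianFourier.integral_cexp_neg_mul_sq_norm_add (V := En n) htc Complex.I ξ
  have key : ∀ h : En n, 2 * (1 - Real.cos ⟪ξ, h⟫) * Real.exp (-t * ‖h‖ ^ 2) =
      (2 * (Complex.exp (-t * ‖h‖ ^ 2 + 0 * (⟪ξ, h⟫ : ℝ)) -
        Complex.exp (-t * ‖h‖ ^ 2 + Complex.I * (⟪ξ, h⟫ : ℝ)))).re := by
    intro h
    have a1 : (-t * ‖h‖ ^ 2 + 0 * (⟪ξ, h⟫ : ℝ) : ℂ) = ((-t * ‖h‖ ^ 2 : ℝ) : ℂ) := by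
      push_cast; ring
    have a2 : (-t * ‖h‖ ^ 2 + Complex.I * (⟪ξ, h⟫ : ℝ) : ℂ) =
        ((-t * ‖h‖ ^ 2 : ℝ) : ℂ) + (⟪ξ, h⟫ : ℝ) * Complex.I := by
      push_cast; ring
    rw [a1, a2, Complex.exp_add, Complex.exp_mul_I, ← Complex.ofReal_exp, ← Complex.ofReal_cos,
      ← Complex.ofReal_sin]
    generalize Real.exp (-t * ‖h‖ ^ 2) = e1
    generalize Real.cos ⟪ξ, h⟫ = c1
    generalize Real.sin ⟪ξ, h⟫ = s1
    simp
    ring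
  have ii := (i0.sub i1).const_mul 2
  rw [← ofReal_integral_eq_lintegral_ofReal]
  · congr 1
    simp_rw [key]
    have := integral_re (𝕜 := ℂ) ii
    simp only [RCLike.re_to_complex, Pi.sub_apply] at this
    rw [this, integral_const_mul, integral_sub i0 i1, v0, v1]
    have b1 : ((π : ℂ) / t) ^ ((Module.finrank ℝ (En n) : ℂ) / 2) =
        (((π / t) ^ ((n : ℝ) / 2) : ℝ) : ℂ) := by
      rw [Complex.ofReal_cpow (by positivity)]
      simp
    have b2 : Complex.I ^ 2 * (‖ξ‖ : ℂ) ^ 2 / (4 * t) = ((-(‖ξ‖ ^ 2 / 4 * t⁻¹) : ℝ) : ℂ) := by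
      push_cast; rw [Complex.I_sq]; field_simp
    rw [b1, b2, ← Complex.ofReal_exp]
    have : (2 * ((((π / t) ^ ((n : ℝ) / 2) : ℝ) : ℂ) * Complex.exp (0 ^ 2 * (‖ξ‖ : ℂ) ^ 2 / (4 * t)) - (((π / t) ^ ((n : ℝ) / 2) : ℝ) : ℂ) * (Real.exp (-(‖ξ‖ ^ 2 / 4 * t⁻¹)) : ℝ)) : ℂ) =
      ((2 * (π / t) ^ ((n : ℝ) / 2) * (1 - Real.exp (-(‖ξ‖ ^ 2 / 4 * t⁻¹))) : ℝ) : ℂ) := by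
      simp only [ne_eq, OfNat.ofNat_ne_zero, not_false_eq_true, zero_pow, zero_mul, zero_div, Complex.exp_zero]
      push_cast; ring
    rw [this, Complex.ofReal_re]
  · simp_rw [key]
    exact ii.re
  · refine Eventually.of_forall fun h => ?_
    have := Real.cos_le_one ⟪ξ, h⟫
    have : 0 ≤ 1 - Real.cos ⟪ξ, h⟫ := by linarith
    positivity

lemma Gconst_eq (n : ℕ) {σ : ℝ} (hσ : σ ∈ Ioo (0 : ℝ) 1) :
    Gconst n σ = 2 * π ^ ((n : ℝ) / 2) * Real.Gamma (1 - σ) /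
      (σ * 4 ^ σ * Real.Gamma (σ + (n : ℝ) / 2)) := by
  obtain ⟨h0, h1⟩ := hσ
  have g1 := Real.Gamma_mul_Gamma_add_half σ
  have g2 := Real.Gamma_mul_Gamma_one_sub σ
  have g3 : Real.Gamma (1 + 2 * σ) = 2 * σ * Real.Gamma (2 * σ) := by
    rw [add_comm, Real.Gamma_add_one (by positivity)]
  have p1 := Real.Gamma_pos_of_pos h0
  have p2 := Real.Gamma_pos_of_pos (show 0 < σ + 1 / 2 by linarith)
  have p3 := Real.Gamma_pos_of_pos (show 0 < 2 * σ by linarith)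
  have p4 := Real.Gamma_pos_of_pos (show 0 < 1 - σ by linarith)
  have p5 := Real.Gamma_pos_of_pos (show 0 < σ + (n : ℝ) / 2 by positivity)
  have p6 : 0 < Real.sin (π * σ) := Real.sin_pos_of_pos_of_lt_pi (by positivity)
    (by nlinarith [Real.pi_pos])
  have q1 : (2:ℝ) ^ (1 - 2 * σ) = 2 / 4 ^ σ := by
    rw [Real.rpow_sub (by norm_num), Real.rpow_one, Real.rpow_mul (by norm_num)]; norm_num
  have q2 : π ^ (((n : ℝ) + 1) / 2) = π ^ ((n : ℝ) / 2) * √π := by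
    rw [Real.sqrt_eq_rpow, ← Real.rpow_add Real.pi_pos]; congr 1; ring
  have q3 : √π * √π = π := Real.mul_self_sqrt Real.pi_pos.le
  have q4 : (0:ℝ) < 4 ^ σ := by positivity
  have q5 : 0 < √π := Real.sqrt_pos.2 Real.pi_pos
  have q6 : (0:ℝ) < π ^ ((n : ℝ) / 2) := by positivity
  unfold Gconst
  rw [g3, q2]
  rw [q1] at g1
  rw [eq_div_iff p6.ne'] at g2
  generalize Real.Gamma (σ + 1 / 2) = A at *
  generalize Real.Gamma (2 * σ) = B at *
  generalize Real.Gamma (1 - σ) = C at *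
  generalize Real.Gamma σ = D at *
  generalize Real.sin (π * σ) = S at *
  generalize Real.Gamma (σ + (n : ℝ) / 2) = E at *
  generalize π ^ ((n : ℝ) / 2) = P at *
  generalize √π = R at *
  generalize (4:ℝ) ^ σ = X at *
  have g1' : D * A * X = 2 * B * R := by
    rw [g1]; field_simp
  have key : A * X * R = 2 * B * C * S := by
    apply mul_left_cancel₀ p1.ne'
    linear_combination R * g1' - 2 * B * g2 + 2 * B * q3
  rw [div_eq_div_iff (by positivity) (by positivity)]
  linear_combination 2 * P * σ * E * key

lemma kernel {n : ℕ} {σ : ℝ} (hσ : σ ∈ Ioo (0 : ℝ) 1) (ξ : En n) (hn : 0 < n) :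
    ∫⁻ h : En n, ENNReal.ofReal (2 * (1 - Real.cos ⟪ξ, h⟫) / ‖h‖ ^ ((n : ℝ) + 2 * σ)) =
      ENNReal.ofReal (Gconst n σ * ‖ξ‖ ^ (2 * σ)) := by
  have hσ' := hσ
  obtain ⟨h0, h1⟩ := hσ
  have hc : ∀ h : En n, 0 ≤ 2 * (1 - Real.cos ⟪ξ, h⟫) := fun h => by
    linarith [Real.cos_le_one ⟪ξ, h⟫]
  by_cases hξ : ξ = 0
  · subst hξ
    simp [Real.zero_rpow (show 2 * σ ≠ 0 by positivity)]
  have hξ' : 0 < ‖ξ‖ := norm_pos_iff.2 hξ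
  set A : ℝ := σ + (n : ℝ) / 2 with hA
  have hA0 : 0 < A := by positivity
  have hG := Real.Gamma_pos_of_pos hA0
  have e1 : ∀ h : En n, ENNReal.ofReal (2 * (1 - Real.cos ⟪ξ, h⟫) / ‖h‖ ^ ((n : ℝ) + 2 * σ)) =
      ENNReal.ofReal (1 / Real.Gamma A) * ∫⁻ t in Ioi (0:ℝ),
        ENNReal.ofReal (2 * (1 - Real.cos ⟪ξ, h⟫) * (t ^ (A - 1) * Real.exp (-t * ‖h‖ ^ 2))) := by
    intro h
    by_cases hh : h = 0
    · subst hh; simp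
    have hh' : 0 < ‖h‖ := norm_pos_iff.2 hh
    have := gammaLint hA0 (show 0 < ‖h‖ ^ 2 by positivity)
    simp_rw [ENNReal.ofReal_mul (hc h), show ∀ t : ℝ, -t * ‖h‖ ^ 2 = -(‖h‖ ^ 2 * t) from fun t => by ring]
    rw [lintegral_const_mul _ (by fun_prop), this, ← ENNReal.ofReal_mul (hc h),
      ← ENNReal.ofReal_mul (by positivity)]
    congr 1
    rw [one_div (‖h‖ ^ 2), Real.inv_rpow (by positivity), ← Real.rpow_natCast, ← Real.rpow_mul hh'.le]
    rw [show ((2:ℕ):ℝ) * A = (n : ℝ) + 2 * σ by rw [hA]; push_cast; ring]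
    field_simp
  have e2 : ∀ t ∈ Ioi (0:ℝ), ∫⁻ h : En n,
      ENNReal.ofReal (2 * (1 - Real.cos ⟪ξ, h⟫) * (t ^ (A - 1) * Real.exp (-t * ‖h‖ ^ 2))) =
      ENNReal.ofReal (2 * π ^ ((n : ℝ) / 2)) *
        ENNReal.ofReal (t ^ (σ - 1) * (1 - Real.exp (-(‖ξ‖ ^ 2 / 4 * t⁻¹)))) := by
    intro t ht
    have ht' : (0:ℝ) < t := ht
    simp_rw [show ∀ h : En n, 2 * (1 - Real.cos ⟪ξ, h⟫) * (t ^ (A - 1) * Real.exp (-t * ‖h‖ ^ 2)) =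
      t ^ (A - 1) * (2 * (1 - Real.cos ⟪ξ, h⟫) * Real.exp (-t * ‖h‖ ^ 2)) from fun h => by ring,
      ENNReal.ofReal_mul (show 0 ≤ t ^ (A - 1) by positivity)]
    rw [lintegral_const_mul _ (by fun_prop), kerB ξ ht', ← ENNReal.ofReal_mul (by positivity),
      ← ENNReal.ofReal_mul (by positivity)]
    congr 1
    rw [Real.div_rpow Real.pi_pos.le ht'.le, show A - 1 = σ - 1 + (n : ℝ) / 2 by rw [hA]; ring,
      Real.rpow_add ht']
    field_simp
  simp_rw [e1]
  rw [lintegral_const_mul _ (by fun_prop), lintegral_lintegral_swap (by fun_prop),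
    setLIntegral_congr_fun measurableSet_Ioi e2, lintegral_const_mul _ (by fun_prop),
    kerC hσ' (by positivity), ← ENNReal.ofReal_mul (by positivity),
    ← ENNReal.ofReal_mul (by positivity), Gconst_eq n hσ', ← hA]
  congr 1
  rw [Real.div_rpow (by positivity) (by positivity), ← Real.rpow_natCast ‖ξ‖, ← Real.rpow_mul hξ'.le]
  push_cast
  field_simp
  try ring

lemma pl_conv {n : ℕ} (φ : SchwartzMap (En n) ℂ) : ∃ ψ : SchwartzMap (En n) ℂ,
    (∀ y, ψ y = φ ((2 * π) • y)) ∧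
    ∀ x, ftIntegral (fun y => φ y) x = (((2 * π) ^ n : ℝ) : ℂ) * FourierTransform.fourier ψ x := by
  have h2 : (2 * π : ℝ) ≠ 0 := by positivity
  let L : En n ≃L[ℝ] En n := ContinuousLinearEquiv.smulLeft (Units.mk0 (2 * π : ℝ) h2)
  have hL : ∀ y, L y = (2 * π) • y := fun y => rfl
  refine ⟨SchwartzMap.compCLMOfContinuousLinearEquiv ℂ L φ, fun y => by simp [hL], fun x => ?_⟩
  rw [SchwartzMap.fourier_coe, Real.fourier_eq']
  have := Measure.integral_comp_smul (volume : Measure (En n))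
    (fun z : En n => φ z * Complex.exp (-(Complex.I * (⟪z, x⟫ : ℝ)))) (2 * π)
  have e : ∀ y : En n, Complex.exp (↑(-2 * π * inner ℝ y x) * Complex.I) •
      (SchwartzMap.compCLMOfContinuousLinearEquiv ℂ L φ) y =
      (fun z : En n => φ z * Complex.exp (-(Complex.I * (⟪z, x⟫ : ℝ)))) ((2 * π) • y) := by
    intro y
    simp only [SchwartzMap.compCLMOfContinuousLinearEquiv_apply, Function.comp, hL, smul_eq_mul,
      real_inner_smul_left]
    rw [mul_comm]; congr 2; push_cast; ring
  simp_rw [e]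
  rw [this, ftIntegral, abs_of_pos (by positivity), finrank_euclideanSpace_fin, Complex.real_smul,
    ← mul_assoc, ← Complex.ofReal_mul, mul_inv_cancel₀ (by positivity), Complex.ofReal_one, one_mul]

lemma sq_lint {n : ℕ} (f : En n → ℂ) :
    ∫⁻ x, ‖f x‖ₑ ^ 2 = eLpNorm f 2 volume ^ 2 := by
  have := eLpNorm_nnreal_pow_eq_lintegral (μ := (volume : Measure (En n))) (f := f) (p := 2) (by norm_num)
  norm_num at this
  exact this.symm

lemma planch {n : ℕ} {v w : En n → ℂ} (hv : MemLp v 2 volume) (hw : IsL2FourierTransform v w) :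
    ∫⁻ ξ, ‖w ξ‖ₑ ^ 2 = ENNReal.ofReal ((2 * π) ^ n) * ∫⁻ x, ‖v x‖ₑ ^ 2 := by
  obtain ⟨hw2, hw⟩ := hw
  have h2 : ((2 * π)⁻¹ : ℝ) ≠ 0 := by positivity
  let V : Lp ℂ 2 (volume : Measure (En n)) := hv.toLp v
  have hV : V =ᵐ[volume] v := hv.coeFn_toLp
  let W : Lp ℂ 2 (volume : Measure (En n)) := FourierTransform.fourier V
  have hWV : ∀ ψ : SchwartzMap (En n) ℂ,
      ∫ x, ψ x * W x = ∫ x, FourierTransform.fourier ψ x * V x := by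
    intro ψ
    have h := MeasureTheory.Lp.fourier_toTemperedDistribution_eq V
    have h' := congrArg (fun T => T ψ) h
    simp only [TemperedDistribution.fourier_apply, Lp.toTemperedDistribution_apply, smul_eq_mul] at h'
    exact h'.symm
  let u : En n → ℂ := fun ξ => W ((2 * π)⁻¹ • ξ)
  let e : En n ≃ᵐ En n := MeasurableEquiv.smul₀ ((2 * π)⁻¹ : ℝ) h2
  have hmap : Measure.map e (volume : Measure (En n)) = ENNReal.ofReal ((2 * π) ^ n) • volume := by
    have := Measure.map_addHaar_smul (volume : Measure (En n)) h2
    rw [finrank_euclideanSpace_fin, abs_of_pos (by positivity)] at this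
    rw [show (((2 * π)⁻¹ : ℝ) ^ n)⁻¹ = (2 * π) ^ n by rw [inv_pow, inv_inv]] at this
    exact this
  have hu : MemLp u 2 volume := by
    have h1 : MemLp W 2 (Measure.map e (volume : Measure (En n))) := by
      rw [hmap]; exact (Lp.memLp W).smul_measure ENNReal.ofReal_ne_top
    exact (memLp_map_measure_iff h1.1 e.measurable.aemeasurable).1 h1
  have hwu : w =ᵐ[volume] u := by
    have hloc : LocallyIntegrable (fun ξ => w ξ - u ξ) volume :=
      (hw2.sub hu).locallyIntegrable (by norm_num)
    have := ae_eq_zero_of_integral_contDiff_smul_eq_zero hloc (fun g g_smooth g_cpt => ?_)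
    · filter_upwards [this] with x hx
      exact sub_eq_zero.1 hx
    have hg₁ : HasCompactSupport (Complex.ofRealCLM ∘ g) := g_cpt.comp_left rfl
    have hg₂ : ContDiff ℝ (⊤ : ℕ∞) (Complex.ofRealCLM ∘ g) := by fun_prop
    let φ : SchwartzMap (En n) ℂ := hg₁.toSchwartzMap hg₂
    have hφ : ∀ x, φ x = (g x : ℂ) := fun x => rfl
    have i1 : Integrable (fun ξ => w ξ * φ ξ) volume := hw2.integrable_mul (φ.memLp 2 volume)
    have i2 : Integrable (fun ξ => u ξ * φ ξ) volume := hu.integrable_mul (φ.memLp 2 volume)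
    have : ∀ x, g x • (w x - u x) = w x * φ x - u x * φ x := by
      intro x; rw [hφ, Complex.real_smul]; ring
    simp_rw [this]
    rw [integral_sub i1 i2, hw φ, sub_eq_zero]
    obtain ⟨ψ, hψ1, hψ2⟩ := pl_conv φ
    simp_rw [hψ2]
    have s1 : ∫ x, v x * ((((2 * π) ^ n : ℝ) : ℂ) * FourierTransform.fourier ψ x) =
        (((2 * π) ^ n : ℝ) : ℂ) * ∫ x, ψ x * W x := by
      rw [hWV, ← integral_const_mul]
      apply integral_congr_ae
      filter_upwards [hV] with x hx
      rw [hx]; ring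
    rw [s1]
    have := Measure.integral_comp_smul (volume : Measure (En n)) (fun z => φ ((2 * π) • z) * W z) ((2 * π)⁻¹)
    rw [finrank_euclideanSpace_fin, abs_of_pos (by positivity),
      show (((2 * π)⁻¹ : ℝ) ^ n)⁻¹ = (2 * π) ^ n by rw [inv_pow, inv_inv], Complex.real_smul] at this
    simp_rw [hψ1]
    rw [← this]
    congr 1; ext x
    rw [smul_smul, mul_inv_cancel₀ (by positivity), one_smul, mul_comm]
  have hnorm : ∫⁻ x, ‖W x‖ₑ ^ 2 = ∫⁻ x, ‖v x‖ₑ ^ 2 := by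
    rw [sq_lint, sq_lint, ← eLpNorm_congr_ae hV]
    congr 1
    have := MeasureTheory.Lp.norm_fourier_eq V
    rw [Lp.norm_def, Lp.norm_def] at this
    exact (ENNReal.toReal_eq_toReal_iff' (Lp.eLpNorm_ne_top _) (Lp.eLpNorm_ne_top _)).1 this
  have : ∫⁻ ξ, ‖w ξ‖ₑ ^ 2 = ∫⁻ ξ, ‖u ξ‖ₑ ^ 2 := by
    apply lintegral_congr_ae
    filter_upwards [hwu] with x hx
    rw [hx]
  rw [this, ← hnorm, ← smul_eq_mul, ← lintegral_smul_measure, ← hmap, lintegral_map_equiv]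
  rfl

lemma char_tg {n : ℕ} (h : En n) :
    Function.HasTemperateGrowth (fun ξ : En n => Complex.exp (Complex.I * (⟪h, ξ⟫ : ℝ)) - 1) := by
  have h1 : Function.HasTemperateGrowth (fun t : ℝ => Complex.exp (Complex.I * (t : ℂ))) := by
    refine ⟨(contDiff_const.mul Complex.ofRealCLM.contDiff).cexp, fun k => ⟨0, 1, fun t => ?_⟩⟩
    have : ∀ k : ℕ, iteratedDeriv k (fun t : ℝ => Complex.exp (Complex.I * (t : ℂ))) =
        fun t : ℝ => Complex.I ^ k * Complex.exp (Complex.I * (t : ℂ)) := by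
      intro k
      induction k with
      | zero => ext; simp
      | succ k ih =>
        rw [iteratedDeriv_succ, ih]
        ext t
        have h1 : HasDerivAt (fun t : ℝ => Complex.I * (t : ℂ)) (Complex.I * 1) t :=
          (HasDerivAt.ofReal_comp (hasDerivAt_id t)).const_mul _
        rw [(h1.cexp.const_mul _).deriv]
        ring
    rw [norm_iteratedFDeriv_eq_norm_iteratedDeriv, this]
    simp [mul_comm Complex.I, Complex.norm_exp_ofReal_mul_I]
  have h2 : Function.HasTemperateGrowth (fun ξ : En n => (⟪h, ξ⟫ : ℝ)) :=
    Function.hasTemperateGrowth_inner_right h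
  exact (h1.comp h2).sub (Function.HasTemperateGrowth.const 1)

lemma transl {n : ℕ} {v w : En n → ℂ} (hv : MemLp v 2 volume) (hw : IsL2FourierTransform v w)
    (h : En n) :
    IsL2FourierTransform (fun x => v (x + h) - v x)
      (fun ξ => (Complex.exp (Complex.I * (⟪h, ξ⟫ : ℝ)) - 1) * w ξ) := by
  obtain ⟨hw2, hw⟩ := hw
  have hvh : MemLp (fun x => v (x + h)) 2 volume :=
    hv.comp_measurePreserving (measurePreserving_add_right volume h)
  refine ⟨?_, fun φ => ?_⟩
  · refine MemLp.of_le_mul (c := 2) hw2 ?_ (Eventually.of_forall fun ξ => ?_)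
    · exact AEStronglyMeasurable.mul (by fun_prop) hw2.1
    · rw [norm_mul]
      gcongr
      refine (norm_sub_le _ _).trans ?_
      rw [mul_comm, Complex.norm_exp_ofReal_mul_I]
      norm_num
  · let ψ := SchwartzMap.smulLeftCLM ℂ (fun ξ : En n => Complex.exp (Complex.I * (⟪h, ξ⟫ : ℝ)) - 1) φ
    have hψ : ∀ ξ, ψ ξ = (Complex.exp (Complex.I * (⟪h, ξ⟫ : ℝ)) - 1) * φ ξ := fun ξ => by
      rw [SchwartzMap.smulLeftCLM_apply_apply (char_tg h), smul_eq_mul]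
    have h1 := hw ψ
    have hft : ∀ (ρ : SchwartzMap (En n) ℂ), MemLp (fun x => ftIntegral (fun y => ρ y) x) 2 volume := by
      intro ρ
      obtain ⟨χ, _, h2⟩ := pl_conv ρ
      simp_rw [h2]
      exact ((FourierTransform.fourier χ).memLp 2 volume).const_mul _
    have hi : ∀ x, Integrable (fun y : En n => φ y * Complex.exp (-(Complex.I * (⟪y, x⟫ : ℝ)))) volume := by
      intro x
      refine φ.integrable.mul_bdd (c := 1) (by fun_prop) (Eventually.of_forall fun y => ?_)
      rw [mul_comm, ← neg_mul, ← Complex.ofReal_neg, Complex.norm_exp_ofReal_mul_I]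
    have hψφ : ∀ x, ftIntegral (fun y => ψ y) x =
        ftIntegral (fun y => φ y) (x - h) - ftIntegral (fun y => φ y) x := by
      intro x
      unfold ftIntegral
      rw [← integral_sub (hi _) (hi _)]
      congr 1; ext y
      beta_reduce
      rw [hψ, inner_sub_right, real_inner_comm y h]
      have : Complex.exp (-(Complex.I * ((⟪y, x⟫ - ⟪y, h⟫ : ℝ) : ℂ))) =
        Complex.exp (Complex.I * (⟪y, h⟫ : ℝ)) * Complex.exp (-(Complex.I * (⟪y, x⟫ : ℝ))) := by
        rw [← Complex.exp_add]; congr 1; push_cast; ring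
      rw [this]; ring
    have e1 : ∫ ξ, (Complex.exp (Complex.I * (⟪h, ξ⟫ : ℝ)) - 1) * w ξ * φ ξ = ∫ ξ, w ξ * ψ ξ := by
      congr 1; ext ξ; rw [hψ]; ring
    rw [e1, h1]
    simp_rw [hψφ, mul_sub, sub_mul]
    have hfm : MemLp (fun x => ftIntegral (fun y => φ y) (x - h)) 2 volume :=
      (hft φ).comp_measurePreserving (measurePreserving_sub_right volume h)
    have j1 : Integrable (fun x => v x * ftIntegral (fun y => φ y) (x - h)) volume :=
      hv.integrable_mul hfm
    have j2 : Integrable (fun x => v x * ftIntegral (fun y => φ y) x) volume :=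
      hv.integrable_mul (hft φ)
    have j3 : Integrable (fun x => v (x + h) * ftIntegral (fun y => φ y) x) volume :=
      hvh.integrable_mul (hft φ)
    rw [integral_sub j1 j2, integral_sub j3 j2]
    congr 1
    rw [← integral_add_right_eq_self (fun x => v x * ftIntegral (fun y => φ y) (x - h)) h]
    simp

lemma perh {n : ℕ} {v w : En n → ℂ} (hv : MemLp v 2 volume) (hw : IsL2FourierTransform v w)
    (h : En n) :
    ∫⁻ x, ENNReal.ofReal (‖v (x + h) - v x‖ ^ 2) = ENNReal.ofReal ((2 * π) ^ (-(n : ℝ))) *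
      ∫⁻ ξ, ENNReal.ofReal (2 * (1 - Real.cos ⟪ξ, h⟫) * ‖w ξ‖ ^ 2) := by
  have hvh : MemLp (fun x => v (x + h)) 2 volume :=
    hv.comp_measurePreserving (measurePreserving_add_right volume h)
  have := planch (hvh.sub hv) (transl hv hw h)
  have e1 : ∀ z : ℂ, ENNReal.ofReal (‖z‖ ^ 2) = ‖z‖ₑ ^ 2 := fun z => by
    rw [ENNReal.ofReal_pow (norm_nonneg _), ofReal_norm]
  have e2 : ∀ ξ, ENNReal.ofReal (2 * (1 - Real.cos ⟪ξ, h⟫) * ‖w ξ‖ ^ 2) =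
      ‖(Complex.exp (Complex.I * (⟪h, ξ⟫ : ℝ)) - 1) * w ξ‖ₑ ^ 2 := by
    intro ξ
    rw [← e1, norm_mul, mul_pow, real_inner_comm]
    congr 2
    rw [mul_comm Complex.I, Complex.exp_mul_I, ← Complex.ofReal_cos, ← Complex.ofReal_sin, Complex.sq_norm,
      Complex.normSq_apply]
    have := Real.sin_sq_add_cos_sq ⟪h, ξ⟫
    generalize Real.sin ⟪h, ξ⟫ = s at *
    generalize Real.cos ⟪h, ξ⟫ = c at *
    simp
    linear_combination -this
  simp_rw [e2, e1]
  rw [this, ← mul_assoc, ← ENNReal.ofReal_mul (by positivity), Real.rpow_neg (by positivity),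
    Real.rpow_natCast, inv_mul_cancel₀ (by positivity), ENNReal.ofReal_one, one_mul]
  rfl

lemma mainEq {n : ℕ} (hn : 0 < n) (σ : ℝ) (hσ : σ ∈ Ioo (0 : ℝ) 1)
    (v w : En n → ℂ) (hv : MemLp v 2 volume) (hw : IsL2FourierTransform v w) :
    (∫⁻ x : En n, ∫⁻ y : En n,
        ENNReal.ofReal (‖v x - v y‖ ^ 2 / dist x y ^ ((n : ℝ) + 2 * σ))) =
      ENNReal.ofReal ((2 * π) ^ (-(n : ℝ)) * Gconst n σ) *
        (∫⁻ ξ : En n, ENNReal.ofReal (‖ξ‖ ^ (2 * σ) * ‖w ξ‖ ^ 2)) := by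
  have hvm := hv.1.aemeasurable
  have hwm := hw.1.1.aemeasurable
  have hc : ∀ ξ h : En n, 0 ≤ 2 * (1 - Real.cos ⟪ξ, h⟫) := fun ξ h => by
    linarith [Real.cos_le_one ⟪ξ, h⟫]
  have hG : 0 ≤ Gconst n σ := by
    rw [Gconst_eq n hσ]
    have := Real.Gamma_pos_of_pos (show 0 < 1 - σ by linarith [hσ.2])
    have h0 := hσ.1
    have := Real.Gamma_pos_of_pos (show 0 < σ + (n : ℝ) / 2 by positivity)
    positivity
  have s1 : ∀ x : En n, ∫⁻ y : En n,
        ENNReal.ofReal (‖v x - v y‖ ^ 2 / dist x y ^ ((n : ℝ) + 2 * σ)) =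
      ∫⁻ h : En n, ENNReal.ofReal (‖v (x + h) - v x‖ ^ 2 / ‖h‖ ^ ((n : ℝ) + 2 * σ)) := by
    intro x
    rw [← lintegral_add_left_eq_self _ x]
    congr 1; ext h
    rw [norm_sub_rev, dist_eq_norm]
    congr 3
    rw [sub_add_cancel_left, norm_neg]
  have s2 : ∀ h : En n, ∫⁻ x : En n, ENNReal.ofReal (‖v (x + h) - v x‖ ^ 2 / ‖h‖ ^ ((n : ℝ) + 2 * σ)) =
      ENNReal.ofReal ((2 * π) ^ (-(n : ℝ))) * ∫⁻ ξ : En n,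
        ENNReal.ofReal (2 * (1 - Real.cos ⟪ξ, h⟫) / ‖h‖ ^ ((n : ℝ) + 2 * σ)) *
          ENNReal.ofReal (‖w ξ‖ ^ 2) := by
    intro h
    simp_rw [div_eq_mul_inv]
    simp_rw [ENNReal.ofReal_mul (sq_nonneg _)]
    rw [lintegral_mul_const' _ _ ENNReal.ofReal_ne_top, perh hv hw, mul_assoc,
      ← lintegral_mul_const' _ _ ENNReal.ofReal_ne_top]
    congr 2; ext ξ
    rw [ENNReal.ofReal_mul (hc ξ h), ENNReal.ofReal_mul (hc ξ h)]
    ring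
  simp_rw [s1]
  have m1 : AEMeasurable (fun p : En n × En n => v (p.1 + p.2)) (volume.prod volume) := by
    have q : Measure.QuasiMeasurePreserving (fun p : En n × En n => p.1 + p.2)
        (volume.prod volume) volume :=
      quasiMeasurePreserving_add volume volume
    exact hvm.comp_quasiMeasurePreserving q
  rw [lintegral_lintegral_swap]
  swap
  · have m2 : AEMeasurable (fun p : En n × En n => v p.1) (volume.prod volume) :=
      hvm.comp_quasiMeasurePreserving Measure.quasiMeasurePreserving_fst
    exact ((((m1.sub m2).norm).pow_const 2).div (by fun_prop)).ennreal_ofReal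
  simp_rw [s2]
  rw [lintegral_const_mul' _ _ ENNReal.ofReal_ne_top, lintegral_lintegral_swap]
  swap
  · have m2 : AEMeasurable (fun p : En n × En n => w p.2) (volume.prod volume) :=
      hwm.comp_quasiMeasurePreserving Measure.quasiMeasurePreserving_snd
    exact AEMeasurable.mul (by fun_prop) (m2.norm.pow_const 2).ennreal_ofReal
  rw [ENNReal.ofReal_mul (by positivity), mul_assoc,
    ← lintegral_const_mul' (ENNReal.ofReal (Gconst n σ)) _ ENNReal.ofReal_ne_top]
  congr 1
  refine lintegral_congr fun ξ => ?_
  rw [lintegral_mul_const' _ _ ENNReal.ofReal_ne_top, kernel hσ ξ hn,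
    ENNReal.ofReal_mul hG, ENNReal.ofReal_mul (by positivity), mul_assoc]

theorem statement10 {n : ℕ} (hn : 0 < n) (σ : ℝ) (hσ : σ ∈ Ioo (0 : ℝ) 1)
    (v w : En n → ℂ) (hv : MemLp v 2 volume) (hw : IsL2FourierTransform v w) :
    (∫⁻ x : En n, ∫⁻ y : En n,
        ENNReal.ofReal (‖v x - v y‖ ^ 2 / dist x y ^ ((n : ℝ) + 2 * σ))) =
      ENNReal.ofReal ((2 * π) ^ (-(n : ℝ)) * Gconst n σ) *
        (∫⁻ ξ : En n, ENNReal.ofReal (‖ξ‖ ^ (2 * σ) * ‖w ξ‖ ^ 2)) ∧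
    ((∫⁻ x : En n, ∫⁻ y : En n,
        ENNReal.ofReal (‖v x - v y‖ ^ 2 / dist x y ^ ((n : ℝ) + 2 * σ))) < ∞ ↔
      (∫⁻ ξ : En n, ENNReal.ofReal (‖ξ‖ ^ (2 * σ) * ‖w ξ‖ ^ 2)) < ∞) := by
  have h := mainEq hn σ hσ v w hv hw
  refine ⟨h, ?_⟩
  have hG : 0 < Gconst n σ := by
    rw [Gconst_eq n hσ]
    have := Real.Gamma_pos_of_pos (show 0 < 1 - σ by linarith [hσ.2])
    have h0 := hσ.1
    have := Real.Gamma_pos_of_pos (show 0 < σ + (n : ℝ) / 2 by positivity)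
    positivity
  have hC : 0 < (2 * π) ^ (-(n : ℝ)) * Gconst n σ := by positivity
  rw [h]
  constructor
  · intro h1
    by_contra h2
    rw [not_lt, top_le_iff] at h2
    rw [h2, ENNReal.mul_top (by simpa using hC)] at h1
    exact lt_irrefl _ h1
  · exact fun h1 => ENNReal.mul_lt_top ENNReal.ofReal_lt_top h1
end
end
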